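/- arXiv:1808.04185 — 9 statements merged into one kernel-verified Lean document; each statement's English description precedes it below -/
import Mathlib

section
/- Let n ≥ 1, let U = {1,...,n}, let p, q ≥ 0 be integers, and let 0 < ζ < 1. If 𝓕 is an (n,p,q,ζ)-approximate universal family over U, then the family 𝓕' = { F ∩ {1,...,i} : F ∈ 𝓕, 0 ≤ i ≤ n } is a strict (n,p,q,ζ)-approximate universal family over U. -/
/-- `𝓕` is an `(n,p,q,ζ)`-approximate universal family over the universe `{1,…,n}`:
it is a family of subsets of `{1,…,n}` such that for every pair of disjoint sets
`A, B ⊆ {1,…,n}` with `|A| = p` and `|B| = q` there is `F ∈ 𝓕` with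
`|A \ F| ≤ ⌊ζ·p⌋` and `B ∩ F = ∅`. -/
def IsApproxUniversal (n p q : ℕ) (ζ : ℝ) (𝓕 : Set (Finset ℕ)) : Prop :=
  (∀ F ∈ 𝓕, F ⊆ Finset.Icc 1 n) ∧
  ∀ A B : Finset ℕ, A ⊆ Finset.Icc 1 n → B ⊆ Finset.Icc 1 n → Disjoint A B →
    A.card = p → B.card = q →
    ∃ F ∈ 𝓕, (A \ F).card ≤ ⌊ζ * (p : ℝ)⌋₊ ∧ Disjoint B F

/-- `𝓕` is a strict `(n,p,q,ζ)`-approximate universal family over `{1,…,n}`: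
for every such pair `A, B` there is `F ∈ 𝓕` with `|A \ F| = ⌊ζ·p⌋` and `B ∩ F = ∅`. -/
def IsStrictApproxUniversal (n p q : ℕ) (ζ : ℝ) (𝓕 : Set (Finset ℕ)) : Prop :=
  (∀ F ∈ 𝓕, F ⊆ Finset.Icc 1 n) ∧
  ∀ A B : Finset ℕ, A ⊆ Finset.Icc 1 n → B ⊆ Finset.Icc 1 n → Disjoint A B →
    A.card = p → B.card = q →
    ∃ F ∈ 𝓕, (A \ F).card = ⌊ζ * (p : ℝ)⌋₊ ∧ Disjoint B F

/-- Truncating `F` to `{1,…,i}`, the number of elements of `A` that are missed takes every value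
between its value at some `i` and `|A|`. -/
theorem exists_card_sdiff_inter_Icc_eq (A F : Finset ℕ) {m : ℕ} (hm : m ≤ A.card) (i : ℕ)
    (hi : (A \ (F ∩ Finset.Icc 1 i)).card ≤ m) :
    ∃ j ≤ i, (A \ (F ∩ Finset.Icc 1 j)).card = m := by
  induction i with
  | zero => exact ⟨0, le_rfl, le_antisymm hi (by simpa using hm)⟩
  | succ k ih =>
    rcases hi.eq_or_lt with h | h
    · exact ⟨k + 1, le_rfl, h⟩
    · have hsub : A \ (F ∩ Finset.Icc 1 k) ⊆
          insert (k + 1) (A \ (F ∩ Finset.Icc 1 (k + 1))) := by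
        intro x
        simp only [Finset.mem_sdiff, Finset.mem_inter, Finset.mem_Icc, Finset.mem_insert]
        grind
      have hcard := (Finset.card_le_card hsub).trans (Finset.card_insert_le _ _)
      obtain ⟨j, hj, hjm⟩ := ih (by omega)
      exact ⟨j, by omega, hjm⟩

/-- If `𝓕` is an `(n,p,q,ζ)`-approximate universal family over `{1,…,n}`, then the family
`𝓕' = { F ∩ {1,…,i} : F ∈ 𝓕, 0 ≤ i ≤ n }` is a strict `(n,p,q,ζ)`-approximate universal
family. -/
theorem stmt_0 (n p q : ℕ) (hn : 1 ≤ n) (ζ : ℝ) (hζ0 : 0 < ζ) (hζ1 : ζ < 1)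
    (𝓕 : Set (Finset ℕ)) (h𝓕 : IsApproxUniversal n p q ζ 𝓕) :
    IsStrictApproxUniversal n p q ζ
      {G : Finset ℕ | ∃ F ∈ 𝓕, ∃ i ≤ n, G = F ∩ Finset.Icc 1 i} := by
  obtain ⟨hsub, huniv⟩ := h𝓕
  refine ⟨?_, fun A B hA hB hAB hAp hBq => ?_⟩
  · rintro _ ⟨F, hF, i, -, rfl⟩
    exact Finset.inter_subset_left.trans (hsub F hF)
  · obtain ⟨F, hF, hAF, hBF⟩ := huniv A B hA hB hAB hAp hBq
    have hm : ⌊ζ * (p : ℝ)⌋₊ ≤ A.card := by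
      rw [hAp]
      exact Nat.floor_le_of_le (mul_le_of_le_one_left p.cast_nonneg hζ1.le)
    obtain ⟨j, hj, hjm⟩ := exists_card_sdiff_inter_Icc_eq A F hm n
      (by rwa [Finset.inter_eq_left.mpr (hsub F hF)])
    exact ⟨_, ⟨F, hF, j, hj, rfl⟩, hjm, hBF.mono_right Finset.inter_subset_left⟩
end

section
/- For c = 1 + 1/√5 and α = 1 - 1/√5, one has φ_c(α) = 3/2 + √5/2, where φ_c(α) = c^(2-α) / (α^α · (c-α)^(2-2α)). -/
open Real

/-- `φ_c(α) = c^(2-α) / (α^α · (c-α)^(2-2α))` for `α ≠ 0`, and `φ_c(0) = 1`. -/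
noncomputable def phi (c α : ℝ) : ℝ :=
  if α = 0 then 1 else c ^ (2 - α) / (α ^ α * (c - α) ^ (2 - 2 * α))

/-- If `1 + s = 2 s g` and `1 - s = 2 s / g`, then `φ_{1+s}(1-s) = g ^ 2`. -/
theorem phi_one_add_one_sub {s g : ℝ} (hs : 0 < s) (hg : 0 < g)
    (hadd : 1 + s = 2 * s * g) (hsub : 1 - s = 2 * s / g) :
    phi (1 + s) (1 - s) = g ^ 2 := by
  have h2s : 0 < 2 * s := by positivity
  have hα : 1 - s ≠ 0 := by rw [hsub]; positivity
  have hc : (1 + s) ^ (1 + s) = (2 * s) ^ (1 + s) * g ^ (1 + s) := by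
    conv_lhs => rw [show (1 + s) ^ (1 + s) = (2 * s * g) ^ (1 + s) by rw [← hadd]]
    exact Real.mul_rpow h2s.le hg.le
  have ha : (1 - s) ^ (1 - s) = (2 * s) ^ (1 - s) / g ^ (1 - s) := by
    conv_lhs => rw [show (1 - s) ^ (1 - s) = (2 * s / g) ^ (1 - s) by rw [← hsub]]
    exact Real.div_rpow h2s.le hg.le _
  have hpow : (2 * s) ^ (1 + s) = (2 * s) ^ (1 - s) * (2 * s) ^ (2 * s) := by
    rw [← Real.rpow_add h2s]; congr 1; ring
  have hgpow : g ^ (1 + s) * g ^ (1 - s) = g ^ 2 := by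
    rw [← Real.rpow_add hg, ← Real.rpow_natCast]; congr 1; push_cast; ring
  rw [phi, if_neg hα, show 2 - (1 - s) = 1 + s by ring,
    show 1 + s - (1 - s) = 2 * s by ring, show 2 - 2 * (1 - s) = 2 * s by ring,
    hc, ha, hpow, ← hgpow]
  have h1 := Real.rpow_pos_of_pos h2s (1 - s)
  have h2 := Real.rpow_pos_of_pos h2s (2 * s)
  have h3 := Real.rpow_pos_of_pos hg (1 - s)
  generalize (2 * s) ^ (1 - s) = x at *
  generalize (2 * s) ^ (2 * s) = y at *
  generalize g ^ (1 - s) = z at *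
  field_simp

/-- For `c = 1 + 1/√5` and `α = 1 - 1/√5`, one has `φ_c(α) = 3/2 + √5/2`. -/
theorem stmt_3 :
    phi (1 + 1 / Real.sqrt 5) (1 - 1 / Real.sqrt 5) = 3 / 2 + Real.sqrt 5 / 2 := by
  have h5 : 0 < Real.sqrt 5 := by positivity
  have hsq : Real.sqrt 5 ^ 2 = 5 := Real.sq_sqrt (by norm_num)
  rw [phi_one_add_one_sub (g := (1 + Real.sqrt 5) / 2) (by positivity) (by positivity)]
  · linear_combination hsq / 4
  · field_simp
    ring
  · field_simp
    linear_combination hsq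
end

section
/- For c = 1 + 1/√5, every α ∈ [0,1] satisfies φ_c(α) ≤ 3/2 + √5/2; that is, the function φ_c attains its maximum over [0,1] at α = 1 - 1/√5. -/
open Real

/-- If `s > 0` satisfies `5 s² = 1`, then `φ_{1+s}` is bounded on `(0,1]` by `(1+s)/(1-s)`, its value
at `1 - s`. -/
lemma phi_one_add_le {s α : ℝ} (hs : 0 < s) (hs5 : 5 * s ^ 2 = 1) (hα : 0 < α) (hα1 : α ≤ 1) :
    phi (1 + s) α ≤ (1 + s) / (1 - s) := by
  have hs1 : 0 < 1 - s := by nlinarith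
  have hc : 0 < 1 + s := by linarith
  have hd : 0 < 1 + s - α := by linarith
  have h2s : 2 * log (2 * s) = log (1 + s) + log (1 - s) := by
    rw [← log_mul hc.ne' hs1.ne', ← log_rpow (by positivity)]
    congr 1
    rw [rpow_two]
    linarith
  have h1 : log (1 - s) - log α ≤ (1 - s) / α - 1 := by
    rw [← log_div hs1.ne' hα.ne']
    exact log_le_sub_one_of_pos (by positivity)
  have h2 : log (2 * s) - log (1 + s - α) ≤ 2 * s / (1 + s - α) - 1 := by
    rw [← log_div (by positivity) hd.ne']
    exact log_le_sub_one_of_pos (by positivity)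
  have h1' := mul_le_mul_of_nonneg_left h1 hα.le
  have h2' := mul_le_mul_of_nonneg_left h2 (show 0 ≤ 2 - 2 * α by linarith)
  have key : α * ((1 - s) / α - 1) + (2 - 2 * α) * (2 * s / (1 + s - α) - 1) ≤ 0 := by
    have : α * ((1 - s) / α - 1) + (2 - 2 * α) * (2 * s / (1 + s - α) - 1)
        = -((1 - s - α) ^ 2 / (1 + s - α)) := by
      field_simp
      ring
    rw [this]
    exact neg_nonpos.2 (by positivity)
  rw [phi, if_neg hα.ne', ← log_le_log_iff (by positivity) (by positivity),
    log_div (by positivity) (by positivity), log_mul (by positivity) (by positivity),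
    log_rpow hc, log_rpow hα, log_rpow hd, log_div hc.ne' hs1.ne']
  linear_combination h1' + h2' + key - (1 - α) * h2s

/-- For `c = 1 + 1/√5`, every `α ∈ [0,1]` satisfies `φ_c(α) ≤ 3/2 + √5/2`. -/
theorem stmt_4 :
    ∀ α ∈ Set.Icc (0 : ℝ) 1,
      phi (1 + 1 / Real.sqrt 5) α ≤ 3 / 2 + Real.sqrt 5 / 2 := by
  rintro α ⟨hα, hα1⟩
  have h5 : √5 ^ 2 = (5 : ℝ) := sq_sqrt (by norm_num)
  have hpos : 0 < √(5 : ℝ) := by positivity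
  rcases hα.eq_or_lt with rfl | hα
  · rw [phi, if_pos rfl]
    linarith
  · refine (phi_one_add_le (by positivity) (by rw [div_pow, h5]; norm_num) hα hα1).trans_eq ?_
    have h1 : √(5 : ℝ) - 1 ≠ 0 := by nlinarith
    have h2 : 1 - 1 / √(5 : ℝ) ≠ 0 := by
      rw [one_sub_div hpos.ne']
      exact div_ne_zero h1 hpos.ne'
    rw [div_eq_iff h2]
    field_simp
    linear_combination -h5
end

section
/- For every real c ≥ 1 there exists α ∈ (0,1] such that φ_c(α) ≥ 3/2 + √5/2; that is, the choice c = 1 + 1/√5 is optimal in the sense that no c ≥ 1 makes the maximum of φ_c over [0,1] smaller than 3/2 + √5/2. -/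
open Real

/-- Weighted AM-GM with weights `(1 - s) / (1 + s)` and `2 s / (1 + s)`, in power form. -/
theorem div_rpow_two_mul_le_div_rpow_one_add {s c : ℝ} (hs : 0 < s) (hs1 : s < 1)
    (hc : 1 - s ≤ c) :
    ((c - (1 - s)) / (2 * s)) ^ (2 * s) ≤ (c / (1 + s)) ^ (1 + s) := by
  have hx : 0 ≤ (c - (1 - s)) / (2 * s) := div_nonneg (by linarith) (by linarith)
  have h := Real.geom_mean_le_arith_mean2_weighted (w₁ := (1 - s) / (1 + s))
    (w₂ := 2 * s / (1 + s)) (p₁ := 1) (div_nonneg (by linarith) (by linarith)) (by positivity)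
    zero_le_one hx (by field_simp; ring)
  have hsum : (1 - s) / (1 + s) * 1 + 2 * s / (1 + s) * ((c - (1 - s)) / (2 * s))
      = c / (1 + s) := by
    field_simp
    ring
  rw [hsum, Real.one_rpow, one_mul] at h
  calc ((c - (1 - s)) / (2 * s)) ^ (2 * s)
      = (((c - (1 - s)) / (2 * s)) ^ (2 * s / (1 + s))) ^ (1 + s) := by
        rw [← Real.rpow_mul hx]
        congr 1
        field_simp
    _ ≤ (c / (1 + s)) ^ (1 + s) :=
        Real.rpow_le_rpow (Real.rpow_nonneg hx _) h (by linarith)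

/-- If `5 s² = 1`, the powers at the critical point collapse to a rational function of `s`. -/
theorem one_add_rpow_one_add_eq {s : ℝ} (hs : 0 < s) (hs1 : s < 1) (h5 : 5 * s ^ 2 = 1) :
    (1 + s) ^ (1 + s) = (1 + s) / (1 - s) * (1 - s) ^ (1 - s) * (2 * s) ^ (2 * s) := by
  have h1 : 0 < 1 - s := by linarith
  have h2 : 0 < 1 + s := by linarith
  have hsq : (2 * s) ^ (2 * s) = (1 + s) ^ s * (1 - s) ^ s := by
    rw [Real.rpow_mul (by positivity), ← Real.mul_rpow h2.le h1.le, Real.rpow_two]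
    congr 1
    nlinarith
  rw [hsq, Real.rpow_add h2, Real.rpow_sub h1, Real.rpow_one, Real.rpow_one]
  have := (Real.rpow_pos_of_pos h1 s).ne'
  field_simp

/-- For every real `c ≥ 1` there exists `α ∈ (0,1]` with `φ_c(α) ≥ 3/2 + √5/2`. -/
theorem stmt_5 (c : ℝ) (hc : 1 ≤ c) :
    ∃ α ∈ Set.Ioc (0 : ℝ) 1, 3 / 2 + Real.sqrt 5 / 2 ≤ phi c α := by
  have h5 : Real.sqrt 5 ^ 2 = 5 := Real.sq_sqrt (by norm_num)
  have hr : 1 < Real.sqrt 5 := Real.lt_sqrt_of_sq_lt (by norm_num)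
  obtain ⟨s, hs⟩ : ∃ s, s = (Real.sqrt 5)⁻¹ := ⟨_, rfl⟩
  have hs0 : 0 < s := by rw [hs]; positivity
  have hs1 : s < 1 := by rw [hs]; exact inv_lt_one_of_one_lt₀ hr
  have hss : 5 * s ^ 2 = 1 := by rw [hs, inv_pow, h5]; norm_num
  have hval : 3 / 2 + Real.sqrt 5 / 2 = (1 + s) / (1 - s) := by
    have hrs : Real.sqrt 5 * s = 1 := by rw [hs]; exact mul_inv_cancel₀ (by positivity)
    have hr5 : Real.sqrt 5 = 5 * s := by
      linear_combination 5 * s * hrs - Real.sqrt 5 * hss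
    rw [eq_div_iff (by linarith), hr5]
    linear_combination (-1 / 2) * hss
  have h1 : 0 < 1 - s := by linarith
  have hcs : 0 < c - (1 - s) := by linarith
  refine ⟨1 - s, ⟨h1, by linarith⟩, ?_⟩
  have ha : 2 - (1 - s) = 1 + s := by ring
  have hb : 2 - 2 * (1 - s) = 2 * s := by ring
  rw [hval, phi, if_neg h1.ne', ha, hb, le_div_iff₀ (by positivity)]
  have h := div_rpow_two_mul_le_div_rpow_one_add hs0 hs1 (c := c) (by linarith)
  rw [Real.div_rpow hcs.le (by positivity), Real.div_rpow (by linarith) (by positivity),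
    div_le_div_iff₀ (by positivity) (by positivity), one_add_rpow_one_add_eq hs0 hs1 hss] at h
  refine le_of_mul_le_mul_right (le_of_eq_of_le ?_ h)
    (Real.rpow_pos_of_pos (by positivity : 0 < 2 * s) (2 * s))
  ring
end

section
/- For c = 1 + 1/√5, the function φ_c is monotonically nondecreasing on the interval (0, 1 - 1/√5]; that is, for all α, β with 0 < α ≤ β ≤ 1 - 1/√5, one has φ_c(α) ≤ φ_c(β). -/
open Real

/-- The logarithm of `phi c x` for `0 < x < c`. -/
noncomputable def logPhi (c x : ℝ) : ℝ :=
  (2 - x) * log c - x * log x - (2 - 2 * x) * log (c - x)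

lemma phi_eq_exp_logPhi {c x : ℝ} (hx : 0 < x) (hxc : x < c) :
    phi c x = exp (logPhi c x) := by
  have hc : 0 < c := hx.trans hxc
  rw [phi, if_neg hx.ne', rpow_def_of_pos hc, rpow_def_of_pos hx,
    rpow_def_of_pos (sub_pos.2 hxc), ← exp_add, ← exp_sub, logPhi]
  congr 1
  ring

lemma hasDerivAt_logPhi {c x : ℝ} (hx : 0 < x) (hxc : x < c) :
    HasDerivAt (logPhi c)
      (1 + log ((c - x) ^ 2 / (c * x)) - 2 * (c - 1) / (c - x)) x := by
  have hc : 0 < c := hx.trans hxc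
  have hcx : 0 < c - x := sub_pos.2 hxc
  have h₁ := ((hasDerivAt_id x).const_sub 2).mul_const (log c)
  have h₂ := (hasDerivAt_id x).mul (hasDerivAt_log hx.ne')
  have h₃ := (((hasDerivAt_id x).const_mul 2).const_sub 2).mul
    (((hasDerivAt_id x).const_sub c).log hcx.ne')
  refine ((h₁.sub h₂).sub h₃).congr_deriv ?_
  rw [log_div (by positivity) (by positivity), log_pow, log_mul hc.ne' hx.ne']
  simp only [id]
  push_cast
  field_simp
  ring

/-- The derivative of `logPhi (1 + s)` is nonnegative on `(0, 1 - s]` when `s = 1 / √5`. -/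
lemma deriv_logPhi_nonneg {s x : ℝ} (hs : 0 < s) (hs2 : s ^ 2 = 1 / 5) (hx : 0 < x)
    (hxs : x ≤ 1 - s) :
    0 ≤ 1 + log ((1 + s - x) ^ 2 / ((1 + s) * x)) - 2 * (1 + s - 1) / (1 + s - x) := by
  have hy : 0 < 1 + s - x := by linarith
  have hlog := one_sub_inv_le_log_of_pos
    (show 0 < (1 + s - x) ^ 2 / ((1 + s) * x) by positivity)
  have key : 0 ≤ 2 - ((1 + s - x) ^ 2 / ((1 + s) * x))⁻¹ - 2 * (1 + s - 1) / (1 + s - x) := by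
    have hfactor : 2 - ((1 + s - x) ^ 2 / ((1 + s) * x))⁻¹ - 2 * (1 + s - 1) / (1 + s - x)
        = (1 - s - x) * (2 * (1 + s - x) + (1 + 3 * s)) / (1 + s - x) ^ 2 := by
      field_simp
      linear_combination 5 * hs2
    rw [hfactor]
    have : 0 ≤ 1 - s - x := by linarith
    positivity
  linarith

/-- For `c = 1 + 1/√5`, the function `φ_c` is monotonically nondecreasing on
`(0, 1 - 1/√5]`. -/
theorem stmt_7 (α β : ℝ) (hα : 0 < α) (hαβ : α ≤ β) (hβ : β ≤ 1 - 1 / Real.sqrt 5) :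
    phi (1 + 1 / Real.sqrt 5) α ≤ phi (1 + 1 / Real.sqrt 5) β := by
  have hs : 0 < 1 / √5 := by positivity
  have hs2 : (1 / √5) ^ 2 = 1 / 5 := by
    rw [div_pow, sq_sqrt (by norm_num)]
    norm_num
  generalize 1 / √5 = s at *
  have hderiv : ∀ x ∈ Set.Icc α β, HasDerivAt (logPhi (1 + s))
      (1 + log ((1 + s - x) ^ 2 / ((1 + s) * x)) - 2 * (1 + s - 1) / (1 + s - x)) x :=
    fun x hx => hasDerivAt_logPhi (hα.trans_le hx.1) (by linarith [hx.2])
  have hmono : MonotoneOn (logPhi (1 + s)) (Set.Icc α β) := by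
    refine monotoneOn_of_deriv_nonneg (convex_Icc α β)
      (fun x hx => (hderiv x hx).continuousAt.continuousWithinAt)
      (fun x hx => (hderiv x (interior_subset hx)).differentiableAt.differentiableWithinAt)
      fun x hx => ?_
    have hx' := interior_subset hx
    rw [(hderiv x hx').deriv]
    exact deriv_logPhi_nonneg hs hs2 (hα.trans_le hx'.1) (hx'.2.trans hβ)
  rw [phi_eq_exp_logPhi hα (by linarith), phi_eq_exp_logPhi (hα.trans_le hαβ) (by linarith)]
  exact exp_le_exp.2
    (hmono (Set.left_mem_Icc.2 hαβ) (Set.right_mem_Icc.2 hαβ) hαβ)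
end

section
/- For c = 1 + 1/√5 and every α ∈ [0, 1/3], one has φ_c(α) ≤ 2.313. -/
open Real

lemma one_add_inv_sqrt_five_bounds :
    1.44721 ≤ 1 + 1 / Real.sqrt 5 ∧ 1 + 1 / Real.sqrt 5 ≤ 1.44722 := by
  have h1 : (2.23606 : ℝ) ≤ Real.sqrt 5 := Real.le_sqrt_of_sq_le (by norm_num)
  have h2 : Real.sqrt 5 ≤ 2.23607 := Real.sqrt_le_iff.2 (by norm_num)
  have h0 : 0 < Real.sqrt 5 := by linarith
  constructor
  · have : (0.44721 : ℝ) ≤ 1 / Real.sqrt 5 := by rw [le_div_iff₀ h0]; linarith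
    linarith
  · have : 1 / Real.sqrt 5 ≤ (0.44722 : ℝ) := by rw [div_le_iff₀ h0]; linarith
    linarith

/-- The logarithm of `phi c (1 / 3)` is at most `log 2.313`. -/
lemma log_phi_one_third_le {c : ℝ} (h1 : 1.44721 ≤ c) (h2 : c ≤ 1.44722) :
    5 / 3 * log c + 1 / 3 * log 3 - 4 / 3 * log (c - 1 / 3) ≤ log 2.313 := by
  have hc : 0 < c := by linarith
  have hc' : 0 < c - 1 / 3 := by linarith
  have key : c ^ 5 * 3 ≤ 2.313 ^ 3 * (c - 1 / 3) ^ 4 := by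
    calc c ^ 5 * 3 ≤ 1.44722 ^ 5 * 3 := by gcongr
      _ ≤ 2.313 ^ 3 * (1.44721 - 1 / 3) ^ 4 := by norm_num
      _ ≤ 2.313 ^ 3 * (c - 1 / 3) ^ 4 := by gcongr
  have h := Real.log_le_log (by positivity) key
  rw [Real.log_mul (by positivity) (by norm_num),
    Real.log_mul (by norm_num) (by positivity), Real.log_pow, Real.log_pow, Real.log_pow] at h
  push_cast at h
  linarith

/-- The logarithm of `phi c α` is at most that of `phi c (1 / 3)` for `α ≤ 1 / 3`. -/
lemma log_phi_le_log_phi_one_third {c α : ℝ} (h1 : 1.44721 ≤ c) (h2 : c ≤ 1.44722)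
    (hα : 0 < α) (hα' : α ≤ 1 / 3) :
    (2 - α) * log c - α * log α - (2 - 2 * α) * log (c - α)
      ≤ 5 / 3 * log c + 1 / 3 * log 3 - 4 / 3 * log (c - 1 / 3) := by
  have hc : 0 < c := by linarith
  have hc' : 0 < c - 1 / 3 := by linarith
  have hcα : 0 < c - α := by linarith
  have entropy : -(α * log α) ≤ α * log 3 + (1 / 3 - α) := by
    have h := Real.log_le_sub_one_of_pos (show 0 < 1 / (3 * α) by positivity)
    rw [one_div, Real.log_inv, Real.log_mul (by norm_num) hα.ne'] at h
    have h' := mul_le_mul_of_nonneg_left h hα.le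
    have e : α * ((3 * α)⁻¹ - 1) = 1 / 3 - α := by field_simp
    linarith
  have tangent : log (c - 1 / 3) - log (c - α) ≤ -((1 / 3 - α) / (c - α)) := by
    have h := Real.log_le_sub_one_of_pos (div_pos hc' hcα)
    rw [Real.log_div hc'.ne' hcα.ne'] at h
    have e : (c - 1 / 3) / (c - α) - 1 = -((1 / 3 - α) / (c - α)) := by field_simp; ring
    linarith
  have ratio : (1 / 2 : ℝ) ≤ (1 - α) / (c - α) := by
    rw [le_div_iff₀ hcα]; linarith
  have logc : log c ≤ c - 1 := Real.log_le_sub_one_of_pos hc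
  have log3 : 1 ≤ log 3 := by
    rw [Real.le_log_iff_exp_le (by norm_num)]
    linarith [Real.exp_one_lt_d9]
  have logc' : 0 ≤ log (c - 1 / 3) := Real.log_nonneg (by linarith)
  have t := mul_le_mul_of_nonneg_left tangent (show 0 ≤ 2 - 2 * α by linarith)
  have e : (2 - 2 * α) * -((1 / 3 - α) / (c - α))
      = -(2 * (1 / 3 - α) * ((1 - α) / (c - α))) := by ring
  have slope : 0 ≤ (1 / 3 - α) *
      (2 * ((1 - α) / (c - α)) + log 3 + 2 * log (c - 1 / 3) - log c - 1) :=
    mul_nonneg (by linarith) (by linarith)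
  linarith

/-- For `c = 1 + 1/√5` and every `α ∈ [0, 1/3]`, one has `φ_c(α) ≤ 2.313`. -/
theorem stmt_9 :
    ∀ α ∈ Set.Icc (0 : ℝ) (1 / 3), phi (1 + 1 / Real.sqrt 5) α ≤ 2.313 := by
  rintro α ⟨h0, hα'⟩
  obtain ⟨h1, h2⟩ := one_add_inv_sqrt_five_bounds
  generalize 1 + 1 / Real.sqrt 5 = c at h1 h2 ⊢
  unfold phi
  split_ifs with h
  · norm_num
  have hα : 0 < α := lt_of_le_of_ne h0 (Ne.symm h)
  have hc : 0 < c := by linarith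
  have hcα : 0 < c - α := by linarith
  rw [← Real.log_le_log_iff (by positivity) (by norm_num),
    Real.log_div (by positivity) (by positivity), Real.log_mul (by positivity) (by positivity),
    Real.log_rpow hc, Real.log_rpow hα, Real.log_rpow hcα, ← sub_sub]
  exact (log_phi_le_log_phi_one_third h1 h2 hα hα').trans (log_phi_one_third_le h1 h2)
end

section
/- Let δ = 0.49533, ζ = 0.712, c_l = 1.136, c_r = 1.645, and set L = (1-ζ)·δ, R = 1-δ+ζ·δ, b = ζ·δ/R, and Y3 = (ζ^ζ·(1-ζ)^(1-ζ))^δ / (L^L · R^R). Then for every α_l ∈ [0,1] and every α_r ∈ [0, b·α_l], one has φ_{c_l}(α_l)^L · φ_{c_r}(α_r)^R · Y3 < 2.5537. -/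
open Real

/-- `δ = 0.49533`. -/
noncomputable def del : ℝ := 0.49533
/-- `ζ = 0.712`. -/
noncomputable def zet : ℝ := 0.712
/-- `L = (1-ζ)·δ`. -/
noncomputable def Lv : ℝ := (1 - zet) * del
/-- `R = 1 - δ + ζ·δ`. -/
noncomputable def Rv : ℝ := 1 - del + zet * del
/-- `b = ζ·δ/R`. -/
noncomputable def bv : ℝ := zet * del / Rv
/-- `Y3 = (ζ^ζ·(1-ζ)^(1-ζ))^δ / (L^L · R^R)`. -/
noncomputable def Y3 : ℝ := (zet ^ zet * (1 - zet) ^ (1 - zet)) ^ del / (Lv ^ Lv * Rv ^ Rv)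

/-- A criterion for approximating `log t` when `t = 2 ^ k * ((1 + x) / (1 - x))`, using five terms
of the power series of `log ((1 + x) / (1 - x))`. -/
lemma abs_log_sub_le {t x q : ℝ} (k : ℤ) (hx : |x| < 1) (ht : t = 2 ^ k * ((1 + x) / (1 - x)))
    (hk : |(k : ℝ)| ≤ 4)
    (hq : |k * 0.69314718055 + 2 * ∑ i ∈ Finset.range 5, x ^ (2 * i + 1) / (2 * i + 1) - q| +
      2 * (|x| ^ 11 / (1 - x ^ 2)) ≤ 0.000000018) :
    |log t - q| ≤ 0.00000002 := by
  have hs := sum_range_sub_log_div_le hx 5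
  obtain ⟨h₁, h₂⟩ := abs_lt.1 hx
  have hlog : log t = k * log 2 + log ((1 + x) / (1 - x)) := by
    have : (1 + x) / (1 - x) ≠ 0 := (div_pos (by linarith) (by linarith)).ne'
    rw [ht, log_mul (by positivity) this, log_zpow]
  have htwo : |(k : ℝ) * (log 2 - 0.69314718055)| ≤ 4 * 0.00000000025 := by
    rw [abs_mul]
    refine mul_le_mul hk ?_ (abs_nonneg _) (by norm_num)
    rw [abs_le]
    constructor <;> linarith [log_two_gt_d9, log_two_lt_d9]
  rw [hlog]
  norm_num only at hs hq htwo ⊢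
  rw [abs_le] at hs htwo ⊢
  obtain ⟨h₃, h₄⟩ := abs_le.1 (le_sub_iff_add_le.2 hq)
  constructor <;> linarith [hs.1, hs.2, htwo.1, htwo.2]

lemma mul_log_sub_mul_log_le {a b : ℝ} (ha : 0 ≤ a) (hb : 0 < b) : a * log b - a * log a ≤ b - a := by
  rcases ha.eq_or_lt with rfl | ha
  · simpa using hb.le
  · have := mul_le_mul_of_nonneg_left (log_le_sub_one_of_pos (div_pos hb ha)) ha.le
    rw [log_div hb.ne' ha.ne', mul_sub, mul_sub, mul_div_cancel₀ _ ha.ne'] at this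
    linarith

lemma phi_pos {c a : ℝ} (hc : 1 < c) (ha : 0 ≤ a) (ha' : a ≤ 1) : 0 < phi c a := by
  unfold phi
  split_ifs with h
  · exact one_pos
  · have : 0 < a := lt_of_le_of_ne ha (Ne.symm h)
    have : 0 < c - a := by linarith
    positivity

lemma log_phi {c a : ℝ} (hc : 1 < c) (ha : 0 ≤ a) (ha' : a ≤ 1) :
    log (phi c a) = (2 - a) * log c - a * log a - (2 - 2 * a) * log (c - a) := by
  unfold phi
  split_ifs with h
  · simp [h]
  · have h₀ : 0 < a := lt_of_le_of_ne ha (Ne.symm h)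
    have h₁ : 0 < c - a := by linarith
    have h₂ : 0 < c := by linarith
    rw [log_div (by positivity) (by positivity), log_mul (by positivity) (by positivity),
      log_rpow h₂, log_rpow h₀, log_rpow h₁]
    ring

/-- The concave function `log ∘ phi c` lies below its tangent line at `a₀`. -/
lemma log_phi_le_tangent {c a a₀ : ℝ} (hc : 1 < c) (ha : 0 ≤ a) (ha' : a ≤ 1)
    (ha₀ : 0 < a₀) (ha₀' : a₀ ≤ 1) :
    log (phi c a) ≤ (2 - a) * log c - a * log a₀ + (a₀ - a) - (2 - 2 * a) * log (c - a₀) +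
      2 * (a - a₀) * ((1 - a₀) / (c - a₀)) := by
  have h₁ : 0 < c - a := by linarith
  have h₂ : 0 < c - a₀ := by linarith
  have hlog := mul_le_mul_of_nonneg_left (log_le_sub_one_of_pos (div_pos h₂ h₁))
    (show 0 ≤ 2 - 2 * a by linarith)
  have hslope : (2 - 2 * a) * ((c - a₀) / (c - a) - 1) ≤
      2 * (a - a₀) * ((1 - a₀) / (c - a₀)) := by
    have : 2 * (a - a₀) * ((1 - a₀) / (c - a₀)) - (2 - 2 * a) * ((c - a₀) / (c - a) - 1) =
        2 * (a - a₀) ^ 2 * (c - 1) / ((c - a₀) * (c - a)) := by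
      field_simp
      ring
    have : 0 ≤ 2 * (a - a₀) ^ 2 * (c - 1) / ((c - a₀) * (c - a)) := by
      have : 0 < c - 1 := by linarith
      positivity
    linarith
  rw [log_div h₂.ne' h₁.ne'] at hlog
  rw [log_phi hc ha ha']
  linarith [mul_log_sub_mul_log_le ha ha₀]

lemma Y3_pos : 0 < Y3 := by
  have hz : 0 < zet := by norm_num [zet]
  have hz' : 0 < 1 - zet := by norm_num [zet]
  have hL : 0 < Lv := by norm_num [Lv, zet, del]
  have hR : 0 < Rv := by norm_num [Rv, zet, del]
  unfold Y3
  positivity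

lemma log_Y3 : log Y3 = 0.49533 * (0.712 * log 0.712 + 0.288 * log 0.288) -
    (0.14265504 * (log 0.288 + log 0.49533) + 0.85734496 * log 0.85734496) := by
  have hz : (1 : ℝ) - zet = 0.288 := by norm_num [zet]
  have hL : Lv = 0.288 * 0.49533 := by norm_num [Lv, zet, del]
  have hR : Rv = 0.85734496 := by norm_num [Rv, zet, del]
  rw [Y3, hz, hL, hR, zet, del, log_div (by positivity) (by positivity),
    log_mul (by positivity) (by positivity), log_rpow (by positivity),
    log_mul (by positivity) (by positivity), log_rpow (by positivity), log_rpow (by positivity),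
    log_rpow (by positivity), log_rpow (by positivity), log_mul (by positivity) (by positivity)]
  norm_num only

/-- With `δ = 0.49533`, `ζ = 0.712`, `c_l = 1.136`, `c_r = 1.645`: for every
`α_l ∈ [0,1]` and every `α_r ∈ [0, b·α_l]`, one has
`φ_{c_l}(α_l)^L · φ_{c_r}(α_r)^R · Y3 < 2.5537`. -/
theorem stmt_10 :
    ∀ αl ∈ Set.Icc (0 : ℝ) 1, ∀ αr ∈ Set.Icc (0 : ℝ) (bv * αl),
      phi 1.136 αl ^ Lv * phi 1.645 αr ^ Rv * Y3 < 2.5537 := by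
  rintro a ⟨ha, ha'⟩ r ⟨hr, hr'⟩
  have hLv : Lv = 0.14265504 := by norm_num [Lv, zet, del]
  have hRv : Rv = 0.85734496 := by norm_num [Rv, zet, del]
  have hb : 0.85734496 * r ≤ 0.35267496 * a := by
    have hbv : bv = 0.35267496 / 0.85734496 := by norm_num [bv, hRv, zet, del]
    rw [hbv] at hr'
    linarith
  have hr₁ : r ≤ 1 := by linarith
  have hpl := phi_pos (c := 1.136) (by norm_num) ha ha'
  have hpr := phi_pos (c := 1.645) (by norm_num) hr hr₁
  have htl := log_phi_le_tangent (c := 1.136) (a₀ := 0.864) (by norm_num) ha ha'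
    (by norm_num) (by norm_num)
  have htr := log_phi_le_tangent (c := 1.645) (a₀ := 0.35528) (by norm_num) hr hr₁
    (by norm_num) (by norm_num)
  rw [show (1.136 : ℝ) - 0.864 = 0.272 by norm_num] at htl
  rw [show (1.645 : ℝ) - 0.35528 = 1.28972 by norm_num] at htr
  have hY := Y3_pos
  rw [hLv, hRv]
  refine (log_lt_log_iff (by positivity) (by norm_num)).1 ?_
  rw [log_mul (by positivity) hY.ne', log_mul (by positivity) (by positivity), log_rpow hpl,
    log_rpow hpr, log_Y3]
  have hcl : |log 1.136 - 0.12751332| ≤ 0.00000002 :=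
    abs_log_sub_le (x := 17 / 267) 0 (by norm_num [abs_lt]) (by norm_num)
      (by norm_num [abs_le, Finset.sum_range_succ]) (by norm_num [Finset.sum_range_succ, abs_le])
  have hal : |log 0.864 - (-0.14618251)| ≤ 0.00000002 :=
    abs_log_sub_le (x := -17 / 233) 0 (by norm_num [abs_lt]) (by norm_num)
      (by norm_num [abs_le, Finset.sum_range_succ]) (by norm_num [Finset.sum_range_succ, abs_le])
  have hdl : |log 0.272 - (-1.30195321)| ≤ 0.00000002 :=
    abs_log_sub_le (x := 11 / 261) (-2) (by norm_num [abs_lt]) (by norm_num)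
      (by norm_num [abs_le, Finset.sum_range_succ]) (by norm_num [Finset.sum_range_succ, abs_le])
  have hcr : |log 1.645 - 0.49774038| ≤ 0.00000002 :=
    abs_log_sub_le (x := -71 / 729) 1 (by norm_num [abs_lt]) (by norm_num)
      (by norm_num [abs_le, Finset.sum_range_succ]) (by norm_num [Finset.sum_range_succ, abs_le])
  have har : |log 0.35528 - (-1.03484907)| ≤ 0.00000002 :=
    abs_log_sub_le (x := -1809 / 10691) (-1) (by norm_num [abs_lt]) (by norm_num)
      (by norm_num [abs_le, Finset.sum_range_succ]) (by norm_num [Finset.sum_range_succ, abs_le])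
  have hdr : |log 1.28972 - 0.25442514| ≤ 0.00000002 :=
    abs_log_sub_le (x := 7243 / 57243) 0 (by norm_num [abs_lt]) (by norm_num)
      (by norm_num [abs_le, Finset.sum_range_succ]) (by norm_num [Finset.sum_range_succ, abs_le])
  have hz : |log 0.712 - (-0.33967737)| ≤ 0.00000002 :=
    abs_log_sub_le (x := -18 / 107) 0 (by norm_num [abs_lt]) (by norm_num)
      (by norm_num [abs_le, Finset.sum_range_succ]) (by norm_num [Finset.sum_range_succ, abs_le])
  have hz' : |log 0.288 - (-1.24479480)| ≤ 0.00000002 :=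
    abs_log_sub_le (x := 19 / 269) (-2) (by norm_num [abs_lt]) (by norm_num)
      (by norm_num [abs_le, Finset.sum_range_succ]) (by norm_num [Finset.sum_range_succ, abs_le])
  have hd : |log 0.49533 - (-0.70253107)| ≤ 0.00000002 :=
    abs_log_sub_le (x := -467 / 99533) (-1) (by norm_num [abs_lt]) (by norm_num)
      (by norm_num [abs_le, Finset.sum_range_succ]) (by norm_num [Finset.sum_range_succ, abs_le])
  have hR : |log 0.85734496 - (-0.15391492)| ≤ 0.00000002 :=
    abs_log_sub_le (x := -445797 / 5804203) 0 (by norm_num [abs_lt]) (by norm_num)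
      (by norm_num [abs_le, Finset.sum_range_succ]) (by norm_num [Finset.sum_range_succ, abs_le])
  have ht : |log 2.5537 - 0.93754329| ≤ 0.00000002 :=
    abs_log_sub_le (x := 5537 / 45537) 1 (by norm_num [abs_lt]) (by norm_num)
      (by norm_num [abs_le, Finset.sum_range_succ]) (by norm_num [Finset.sum_range_succ, abs_le])
  rw [abs_le] at hcl hal hdl hcr har hdr hz hz' hd hR ht
  obtain ⟨s, hs⟩ : ∃ s, s = -log 1.645 - log 0.35528 - 1 + 2 * log 1.28972 +
    2 * ((1 - 0.35528) / 1.28972) := ⟨_, rfl⟩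
  have hs₀ : 0 ≤ s := by linarith
  have hsr := mul_le_mul_of_nonneg_right hb hs₀
  obtain ⟨e, he⟩ : ∃ e, e = 0.14265504 * (-log 1.136 - log 0.864 - 1 + 2 * log 0.272 +
    2 * ((1 - 0.864) / 0.272)) + 0.35267496 * s := ⟨_, rfl⟩
  have he' : e ≤ 0.000015 := by linarith
  have hea : e * a ≤ 0.000015 := by nlinarith
  subst he hs
  linarith
end

section
/- Let U be a set, 𝓢 a family of subsets of U, v ∈ U, and q ≥ 1 an integer. If Ŝ ⊆ 𝓢 q-represents 𝓢, then the family { X ∪ {v} : X ∈ Ŝ, v ∉ X } (q-1)-represents the family { X ∪ {v} : X ∈ 𝓢, v ∉ X }. -/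
/-- `Ŝ` `q`-represents `𝓢` (over the universe `α`): `Ŝ ⊆ 𝓢` and for every `B` with
`|B| ≤ q`, if some `A ∈ 𝓢` is disjoint from `B`, then some `Â ∈ Ŝ` is disjoint from `B`. -/
def Represents {α : Type*} (q : ℕ) (S Shat : Set (Finset α)) : Prop :=
  Shat ⊆ S ∧
    ∀ B : Finset α, B.card ≤ q → (∃ A ∈ S, Disjoint A B) → ∃ A ∈ Shat, Disjoint A B

/-- If `Ŝ ⊆ 𝓢` `q`-represents `𝓢` and `q ≥ 1`, then `{ X ∪ {v} : X ∈ Ŝ, v ∉ X }`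
`(q-1)`-represents `{ X ∪ {v} : X ∈ 𝓢, v ∉ X }`. -/
theorem stmt_17 {α : Type*} [DecidableEq α] (v : α) (q : ℕ) (hq : 1 ≤ q)
    (S Shat : Set (Finset α)) (h : Represents q S Shat) :
    Represents (q - 1) {Y : Finset α | ∃ X ∈ S, v ∉ X ∧ Y = X ∪ {v}}
      {Y : Finset α | ∃ X ∈ Shat, v ∉ X ∧ Y = X ∪ {v}} := by
  obtain ⟨hsub, hrep⟩ := h
  refine ⟨fun Y ⟨X, hX, hv, hY⟩ => ⟨X, hsub hX, hv, hY⟩, ?_⟩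
  rintro B hB ⟨_, ⟨X, hX, hv, rfl⟩, hXB⟩
  rw [Finset.disjoint_union_left, Finset.disjoint_singleton_left] at hXB
  have hcard : (insert v B).card ≤ q := by
    have := Finset.card_insert_le v B
    omega
  obtain ⟨X', hX', hdisj⟩ :=
    hrep (insert v B) hcard ⟨X, hX, Finset.disjoint_insert_right.2 ⟨hv, hXB.1⟩⟩
  rw [Finset.disjoint_insert_right] at hdisj
  exact ⟨X' ∪ {v}, ⟨X', hX', hdisj.1, rfl⟩, Finset.disjoint_union_left.2
    ⟨hdisj.2, Finset.disjoint_singleton_left.2 hXB.2⟩⟩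
end

section
/- Let U be a set partitioned into two disjoint sets U_1 and U_2, let 𝓢 be a family of subsets of U, let v ∈ U_1, and let q_1 ≥ 1 and q_2 ≥ 0 be integers. If Ŝ ⊆ 𝓢 (q_1,q_2)-represents 𝓢, then the family { X ∪ {v} : X ∈ Ŝ, v ∉ X } (q_1 - 1, q_2)-represents the family { X ∪ {v} : X ∈ 𝓢, v ∉ X }. -/
/-- `Ŝ` `(q₁,q₂)`-represents `𝓢` with respect to the partition of the universe `U₁ ∪ U₂`
into disjoint sets `U₁` and `U₂`: `Ŝ ⊆ 𝓢` and for every `B ⊆ U₁ ∪ U₂` with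
`|B ∩ U₁| ≤ q₁` and `|B ∩ U₂| ≤ q₂`, if some `A ∈ 𝓢` is disjoint from `B`, then some
`Â ∈ Ŝ` is disjoint from `B`. -/
def Represents2 {α : Type*} [DecidableEq α] (U₁ U₂ : Finset α) (q₁ q₂ : ℕ)
    (S Shat : Set (Finset α)) : Prop :=
  Shat ⊆ S ∧
    ∀ B : Finset α, B ⊆ U₁ ∪ U₂ → (B ∩ U₁).card ≤ q₁ → (B ∩ U₂).card ≤ q₂ →
      (∃ A ∈ S, Disjoint A B) → ∃ A ∈ Shat, Disjoint A B

/-- Let the universe `U₁ ∪ U₂` be partitioned into disjoint sets `U₁` and `U₂`, let `𝓢` be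
a family of subsets of `U₁ ∪ U₂`, let `v ∈ U₁`, and let `q₁ ≥ 1`, `q₂ ≥ 0`. If `Ŝ ⊆ 𝓢`
`(q₁,q₂)`-represents `𝓢`, then `{ X ∪ {v} : X ∈ Ŝ, v ∉ X }` `(q₁-1, q₂)`-represents
`{ X ∪ {v} : X ∈ 𝓢, v ∉ X }`. -/
theorem stmt_18 {α : Type*} [DecidableEq α] (U₁ U₂ : Finset α) (hU : Disjoint U₁ U₂)
    (v : α) (hv : v ∈ U₁) (q₁ q₂ : ℕ) (hq₁ : 1 ≤ q₁)
    (S Shat : Set (Finset α)) (hS : ∀ A ∈ S, A ⊆ U₁ ∪ U₂)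
    (h : Represents2 U₁ U₂ q₁ q₂ S Shat) :
    Represents2 U₁ U₂ (q₁ - 1) q₂ {Y : Finset α | ∃ X ∈ S, v ∉ X ∧ Y = X ∪ {v}}
      {Y : Finset α | ∃ X ∈ Shat, v ∉ X ∧ Y = X ∪ {v}} := by
  have hv₂ : v ∉ U₂ := Finset.disjoint_left.mp hU hv
  refine ⟨fun Y ⟨X, hX, hvX, hY⟩ => ⟨X, h.1 hX, hvX, hY⟩, ?_⟩
  rintro B hB hB₁ hB₂ ⟨_, ⟨X, hX, hvX, rfl⟩, hXB⟩
  rw [Finset.disjoint_union_left, Finset.disjoint_singleton_left] at hXB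
  obtain ⟨A, hA, hAB⟩ := h.2 (insert v B)
    (Finset.insert_subset (Finset.mem_union_left _ hv) hB)
    (by
      rw [Finset.insert_inter_of_mem hv]
      have := Finset.card_insert_le v (B ∩ U₁)
      omega)
    (by rwa [Finset.insert_inter_of_notMem hv₂])
    ⟨X, hX, Finset.disjoint_insert_right.mpr ⟨hvX, hXB.1⟩⟩
  rw [Finset.disjoint_insert_right] at hAB
  exact ⟨A ∪ {v}, ⟨A, hA, hAB.1, rfl⟩,
    Finset.disjoint_union_left.mpr ⟨hAB.2, Finset.disjoint_singleton_left.mpr hXB.2⟩⟩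
end
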